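/- arXiv:math/0405136 — 3 statements merged into one kernel-verified Lean document; each statement's English description precedes it below -/
import Mathlib

section
/- Let k ≥ 1, 1 ≤ m ≤ k, and n ≥ 1. Write b = n mod (k−m+1) and a = m·⌊n/(k−m+1)⌋. Then the k-conjugate of the rectangular partition (m^n) is (m^n)^{ω_k} = ((k−m+1)^a, b^m), i.e., the partition with a parts equal to k−m+1 followed by m parts equal to b (with the parts equal to b omitted when b = 0). -/
/-- A partition: a weakly decreasing list of positive integers. -/
def IsPartition (l : List ℕ) : Prop :=
  l.Pairwise (· ≥ ·) ∧ ∀ x ∈ l, 0 < x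

/-- The `i`-th part (0-indexed), with parts beyond the length equal to 0. -/
def part (l : List ℕ) (i : ℕ) : ℕ := l.getD i 0

/-- Diagram containment `l ⊆ m`: every part of `l` is at most the corresponding part of `m`. -/
def SubDiag (l m : List ℕ) : Prop := ∀ i, part l i ≤ part m i

/-- A `k`-bounded partition: a partition whose first part is at most `k`. -/
def KBounded (k : ℕ) (l : List ℕ) : Prop := IsPartition l ∧ part l 0 ≤ k

/-- Hook length of the square `(i,j)` (0-indexed) with respect to the skew diagram
`outer/inner`: the number of cells `(i,j')` of the skew diagram with `j' ≥ j` plus the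
number of cells `(i',j)` of the skew diagram with `i' > i`. -/
def hookLen (outer inner : List ℕ) (i j : ℕ) : ℕ :=
  ((Finset.range (part outer i)).filter (fun j' => j ≤ j' ∧ part inner i ≤ j')).card +
  ((Finset.range outer.length).filter
    (fun i' => i < i' ∧ part inner i' ≤ j ∧ j < part outer i')).card

/-- `(outer, inner)` is the `k`-skew diagram of the `k`-bounded partition `l`:
row `i` of `outer/inner` has `l i` cells, every cell of `outer/inner` has hook length
at most `k`, and every square of the inner shape has hook length exceeding `k`. -/
def IsKSkew (k : ℕ) (l outer inner : List ℕ) : Prop :=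
  IsPartition outer ∧ IsPartition inner ∧ SubDiag inner outer ∧
  (∀ i, part outer i - part inner i = part l i) ∧
  (∀ i j, part inner i ≤ j → j < part outer i → hookLen outer inner i j ≤ k) ∧
  (∀ i j, j < part inner i → k < hookLen outer inner i j)

/-- Length of column `j` of the skew diagram `outer/inner`. -/
def colLen (outer inner : List ℕ) (j : ℕ) : ℕ :=
  ((Finset.range outer.length).filter
    (fun i => part inner i ≤ j ∧ j < part outer i)).card

/-- The list of column lengths of the skew diagram `outer/inner`. -/
def skewCols (outer inner : List ℕ) : List ℕ :=
  ((List.range (part outer 0)).map (colLen outer inner)).filter (fun x => decide (x ≠ 0))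

/-- The `k`-conjugate of `l`: the partition whose parts are the column lengths of the
(unique) `k`-skew diagram of `l`. -/
noncomputable def kConj (k : ℕ) (l : List ℕ) : List ℕ :=
  haveI := Classical.dec (∃ p : List ℕ × List ℕ, IsKSkew k l p.1 p.2)
  if h : ∃ p : List ℕ × List ℕ, IsKSkew k l p.1 p.2 then
    skewCols h.choose.1 h.choose.2
  else []

/-- The covering relation of the `k`-Young order on `k`-bounded partitions. -/
def KCover (k : ℕ) (l m : List ℕ) : Prop :=
  KBounded k l ∧ KBounded k m ∧ SubDiag l m ∧
  SubDiag (kConj k l) (kConj k m) ∧ m.sum = l.sum + 1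

/-- The `k`-Young order: reflexive-transitive closure of the covering relation. -/
def KLe (k : ℕ) : List ℕ → List ℕ → Prop := Relation.ReflTransGen (KCover k)

/-- The weakly decreasing rearrangement of the combined parts of two partitions. -/
def punion (l r : List ℕ) : List ℕ := (l ++ r).mergeSort (fun a b => decide (a ≥ b))

/-- The ordinary conjugate of a partition: the list of column lengths of its diagram. -/
def conj (l : List ℕ) : List ℕ :=
  (List.range (part l 0)).map (fun j => (l.filter (fun x => decide (j < x))).length)

theorem part_map_range (f : ℕ → ℕ) (N i : ℕ) :
    part ((List.range N).map f) i = if i < N then f i else 0 := by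
  unfold part
  split_ifs with h
  · simp [List.getD, h]
  · simp [List.getD, h]

theorem card_arm (a b j : ℕ) :
    ((Finset.range a).filter (fun j' => j ≤ j' ∧ b ≤ j')).card = a - max j b := by
  rw [← Nat.card_Ico]
  congr 1
  ext x
  simp only [Finset.mem_filter, Finset.mem_range, Finset.mem_Ico]
  omega

/-- The `i`-th row of the inner shape of the `k`-skew diagram of `(m^n)`, with `c = k - m + 1`. -/
def rectInner (c m n i : ℕ) : ℕ := m * ((n - 1 - i) / c)

theorem card_rectInner_column {c m n : ℕ} (hc : 0 < c) (hm : 0 < m) (s j : ℕ) :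
    ((Finset.range n).filter (fun i => s ≤ i ∧ rectInner c m n i ≤ j ∧
      j < rectInner c m n i + m)).card = min c (n - s - c * (j / m)) := by
  have : (Finset.range n).filter (fun i => s ≤ i ∧ rectInner c m n i ≤ j ∧
      j < rectInner c m n i + m) =
      Finset.Ico (max s (n - c * (j / m) - c)) (n - c * (j / m)) := by
    ext i
    have h1 : rectInner c m n i ≤ j ↔ (n - 1 - i) / c ≤ j / m := by
      rw [rectInner, Nat.le_div_iff_mul_le hm, mul_comm]
    have h2 : j < rectInner c m n i + m ↔ j / m < (n - 1 - i) / c + 1 := by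
      rw [rectInner, Nat.div_lt_iff_lt_mul hm, add_mul, one_mul, mul_comm m]
    have h3 : (n - 1 - i) / c ≤ j / m ↔ n - 1 - i < c * (j / m) + c := by
      rw [← Nat.lt_succ_iff, Nat.div_lt_iff_lt_mul hc, Nat.succ_mul, mul_comm]
    have h4 : j / m < (n - 1 - i) / c + 1 ↔ c * (j / m) ≤ n - 1 - i := by
      rw [Nat.lt_succ_iff, Nat.le_div_iff_mul_le hc, mul_comm]
    simp only [Finset.mem_filter, Finset.mem_range, Finset.mem_Ico, h1, h2, h3, h4]
    omega
  rw [this, Nat.card_Ico]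
  omega

theorem part_replicate (n m i : ℕ) :
    part (List.replicate n m) i = if i < n then m else 0 := by
  unfold part
  split_ifs with h
  · simp [List.getD, h]
  · simp [List.getD, h]

theorem part_pos_iff {l : List ℕ} (hl : IsPartition l) (i : ℕ) : 0 < part l i ↔ i < l.length := by
  unfold part
  constructor
  · intro h
    by_contra hi
    simp [List.getD, Nat.le_of_not_lt hi] at h
  · intro h
    rw [List.getD_eq_getElem _ _ h]
    exact hl.2 _ (List.getElem_mem h)

theorem hookLen_eq {c m n i : ℕ} {outer inner : List ℕ} (hc : 0 < c) (hm : 0 < m)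
    (hlen : outer.length = n)
    (hin : ∀ i', i < i' → i' < n → part inner i' = rectInner c m n i')
    (hout : ∀ i', i < i' → i' < n → part outer i' = rectInner c m n i' + m) (j : ℕ) :
    hookLen outer inner i j =
      part outer i - max j (part inner i) + min c (n - (i + 1) - c * (j / m)) := by
  rw [hookLen, card_arm, hlen, ← card_rectInner_column hc hm]
  congr 2
  apply Finset.filter_congr
  intro x hx
  rw [Finset.mem_range] at hx
  rw [Nat.succ_le_iff]
  refine and_congr_right fun h => ?_
  rw [hin x h hx, hout x h hx]

theorem IsKSkew.part_inner_eq_zero {k m n : ℕ} {outer inner : List ℕ}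
    (h : IsKSkew k (List.replicate n m) outer inner) {i : ℕ} (hi : n ≤ i) :
    part inner i = 0 := by
  obtain ⟨-, -, -, hrow, -, hinner⟩ := h
  have hrow' : ∀ i', i ≤ i' → part outer i' ≤ part inner i' := fun i' hi' => by
    have := hrow i'
    rw [part_replicate, if_neg (by omega)] at this
    omega
  by_contra hne
  have hlt := hinner i 0 (Nat.pos_of_ne_zero hne)
  rw [hookLen, card_arm, Finset.filter_false_of_mem, Finset.card_empty] at hlt
  · have := hrow' i le_rfl
    omega
  · intro x _ hx
    have := hrow' x hx.1.le
    omega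

theorem IsKSkew.part_outer {k m n : ℕ} {outer inner : List ℕ}
    (h : IsKSkew k (List.replicate n m) outer inner) {i : ℕ} (hi : i < n) :
    part outer i = part inner i + m := by
  have h1 := h.2.2.2.1 i
  have h2 := h.2.2.1 i
  rw [part_replicate, if_pos hi] at h1
  omega

theorem IsKSkew.length_outer {k m n : ℕ} {outer inner : List ℕ} (hm : 0 < m)
    (h : IsKSkew k (List.replicate n m) outer inner) : outer.length = n := by
  have key : ∀ i, i < outer.length ↔ i < n := fun i => by
    rw [← part_pos_iff h.1]
    by_cases hi : i < n
    · have := h.part_outer hi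
      omega
    · have h1 := h.2.2.2.1 i
      have h2 := h.part_inner_eq_zero (Nat.le_of_not_lt hi)
      rw [part_replicate, if_neg hi] at h1
      omega
  have h1 := key n
  have h2 := key outer.length
  omega

theorem IsKSkew.part_inner {k m n : ℕ} {outer inner : List ℕ} (hm : 0 < m) (hmk : m ≤ k)
    (h : IsKSkew k (List.replicate n m) outer inner) {i : ℕ} (hi : i < n) :
    part inner i = rectInner (k - m + 1) m n i := by
  induction hr : n - i using Nat.strong_induction_on generalizing i with
  | _ r ih =>
  have hin : ∀ i', i < i' → i' < n → part inner i' = rectInner (k - m + 1) m n i' :=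
    fun i' h1 h2 => ih (n - i') (by omega) h2 rfl
  have hhook := hookLen_eq (Nat.succ_pos (k - m)) hm (h.length_outer hm) hin
    fun i' h1 h2 => by rw [h.part_outer h2, hin i' h1 h2]
  have hout := h.part_outer hi
  have hcell := h.2.2.2.2.1 i (part inner i) le_rfl (by omega)
  rw [hhook, hout] at hcell
  have hdm := Nat.div_add_mod (n - 1 - i) (k - m + 1)
  have hmod := Nat.mod_lt (n - 1 - i) (Nat.succ_pos (k - m))
  apply le_antisymm
  · by_contra! hlt
    have hsq := h.2.2.2.2.2 i _ hlt
    rw [hhook, hout, rectInner, Nat.mul_div_cancel_left _ hm, ← rectInner] at hsq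
    simp only [Nat.succ_eq_add_one] at *
    omega
  · rw [rectInner, mul_comm, ← Nat.le_div_iff_mul_le hm, ← Nat.lt_succ_iff,
      Nat.div_lt_iff_lt_mul (Nat.succ_pos _), Nat.succ_mul, mul_comm]
    simp only [Nat.succ_eq_add_one] at *
    omega

theorem rectInner_antitone (c m n : ℕ) : Antitone (rectInner c m n) := fun _ _ h =>
  Nat.mul_le_mul_left _ (Nat.div_le_div_right (by omega))

theorem isPartition_map_range {f : ℕ → ℕ} (hf : Antitone f) {N : ℕ} (hpos : ∀ i < N, 0 < f i) :
    IsPartition ((List.range N).map f) := by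
  refine ⟨?_, ?_⟩
  · rw [List.pairwise_map]
    exact List.pairwise_lt_range.imp fun h => hf h.le
  · simpa using hpos

theorem exists_isKSkew_rectangle {k m n : ℕ} (hm : 0 < m) (hmk : m ≤ k) :
    ∃ p : List ℕ × List ℕ, IsKSkew k (List.replicate n m) p.1 p.2 := by
  set c := k - m + 1 with hcdef
  have hc : 0 < c := Nat.succ_pos _
  set outer := (List.range n).map fun i => rectInner c m n i + m with houter
  set inner := (List.range (n - c)).map (rectInner c m n) with hinner
  have hin : ∀ i, part inner i = if i < n then rectInner c m n i else 0 := by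
    intro i
    rw [hinner, part_map_range]
    split_ifs with h1 h2 h2
    · rfl
    · omega
    · rw [rectInner, Nat.div_eq_of_lt (by omega), mul_zero]
    · rfl
  have hout : ∀ i, part outer i = if i < n then rectInner c m n i + m else 0 :=
    fun i => part_map_range _ _ _
  have hhook : ∀ i j, hookLen outer inner i j = _ := fun i =>
    hookLen_eq (n := n) (i := i) hc hm (by simp [houter]) (fun i' _ h => by rw [hin, if_pos h])
      (fun i' _ h => by rw [hout, if_pos h])
  refine ⟨(outer, inner), ?_, ?_, ?_, ?_, ?_, ?_⟩
  · exact isPartition_map_range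
      (fun _ _ h => Nat.add_le_add_right (rectInner_antitone c m n h) m) fun _ _ => by omega
  · exact isPartition_map_range (rectInner_antitone c m n) fun i hi =>
      Nat.mul_pos hm (Nat.div_pos (by omega) hc)
  · intro i
    rw [hin, hout]
    split_ifs <;> omega
  · intro i
    rw [hin, hout, part_replicate]
    split_ifs <;> omega
  · intro i j h1 h2
    rw [hhook]
    simp only [hin, hout] at *
    split_ifs at * with hi
    · have h3 : (n - 1 - i) / c ≤ j / m := by
        rwa [Nat.le_div_iff_mul_le hm, mul_comm]
      have h4 := Nat.mul_le_mul_left c h3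
      have hdm := Nat.div_add_mod (n - 1 - i) c
      have hmod := Nat.mod_lt (n - 1 - i) hc
      omega
    · omega
  · intro i j h1
    rw [hhook]
    simp only [hin, hout] at *
    split_ifs at * with hi
    · have h3 : j / m + 1 ≤ (n - 1 - i) / c := by
        rw [Nat.succ_le_iff, Nat.div_lt_iff_lt_mul hm, mul_comm]
        exact h1
      have h4 := Nat.mul_le_mul_left c h3
      rw [mul_add, mul_one] at h4
      have hdm := Nat.div_add_mod (n - 1 - i) c
      omega
    · omega

theorem IsKSkew.colLen_eq {k m n : ℕ} {outer inner : List ℕ} (hm : 0 < m) (hmk : m ≤ k)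
    (h : IsKSkew k (List.replicate n m) outer inner) (j : ℕ) :
    colLen outer inner j = min (k - m + 1) (n - (k - m + 1) * (j / m)) := by
  have := card_rectInner_column (n := n) (Nat.succ_pos (k - m)) hm 0 j
  rw [Nat.sub_zero] at this
  rw [colLen, h.length_outer hm, ← this]
  congr 1
  apply Finset.filter_congr
  intro x hx
  rw [Finset.mem_range] at hx
  simp [h.part_outer hx, h.part_inner hm hmk hx]

theorem filter_map_range_min {c m : ℕ} (hc : 0 < c) (hm : 0 < m) {n : ℕ} (hn : 0 < n) :
    ((List.range (m * ((n - 1) / c) + m)).map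
      (fun j => min c (n - c * (j / m)))).filter (fun x => decide (x ≠ 0)) =
    List.replicate (m * (n / c)) c ++ (if n % c = 0 then [] else List.replicate m (n % c)) := by
  have hdm := Nat.div_add_mod n c
  have hmod := Nat.mod_lt n hc
  have hlen : m * ((n - 1) / c) + m = m * (n / c) + if n % c = 0 then 0 else m := by
    split_ifs with h0
    · have hq : (n - 1) / c + 1 = n / c := by
        have hd : 0 < n / c := Nat.div_pos (Nat.le_of_dvd hn (Nat.dvd_of_mod_eq_zero h0)) hc
        have : (n - 1) / c = n / c - 1 := by
          obtain ⟨q, hq⟩ := Nat.exists_eq_add_of_lt hd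
          rw [hq] at hdm ⊢
          rw [Nat.div_eq_iff hc]
          simp only [zero_add, mul_add, mul_one, Nat.add_sub_cancel] at *
          rw [mul_comm q c]
          omega
        omega
      rw [← hq]
      ring
    · have hq : (n - 1) / c = n / c := by
        rw [Nat.div_eq_iff hc, mul_comm]
        omega
      rw [hq]
  have hfull : (List.range (m * (n / c))).map (fun j => min c (n - c * (j / m))) =
      List.replicate (m * (n / c)) c := by
    rw [List.eq_replicate_iff]
    refine ⟨by simp, ?_⟩
    simp only [List.mem_map, List.mem_range]
    rintro _ ⟨j, hj, rfl⟩
    have h3 : j / m + 1 ≤ n / c := by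
      rwa [Nat.succ_le_iff, Nat.div_lt_iff_lt_mul hm, mul_comm]
    have h4 := Nat.mul_le_mul_left c h3
    rw [mul_add, mul_one] at h4
    omega
  have hrest : (List.range m).map ((fun j => min c (n - c * (j / m))) ∘ (m * (n / c) + ·)) =
      List.replicate m (n % c) := by
    rw [List.eq_replicate_iff]
    refine ⟨by simp, ?_⟩
    simp only [List.mem_map, List.mem_range, Function.comp]
    rintro _ ⟨j, hj, rfl⟩
    rw [Nat.mul_add_div hm, Nat.div_eq_of_lt hj, add_zero]
    omega
  rw [hlen]
  split_ifs with h0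
  · rw [add_zero, hfull, List.append_nil, List.filter_replicate_of_pos (by simp [hc.ne'])]
  · rw [List.range_add, List.map_append, List.map_map, hfull, hrest, List.filter_append,
      List.filter_replicate_of_pos (by simp [hc.ne']), List.filter_replicate_of_pos (by simp [h0])]

/-- the `k`-conjugate of the rectangle `(m^n)` is `((k-m+1)^a, b^m)`
where `b = n mod (k-m+1)` and `a = m⌊n/(k-m+1)⌋` (the parts equal to `b` omitted
when `b = 0`). -/
theorem kConj_rectangle (k m n : ℕ) (hk : 1 ≤ k) (hm : 1 ≤ m) (hmk : m ≤ k) (hn : 1 ≤ n) :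
    kConj k (List.replicate n m) =
      List.replicate (m * (n / (k - m + 1))) (k - m + 1) ++
        (if n % (k - m + 1) = 0 then [] else List.replicate m (n % (k - m + 1))) := by
  have hex := exists_isKSkew_rectangle (n := n) hm hmk
  rw [kConj, dif_pos hex]
  have h := hex.choose_spec
  rw [skewCols, funext (h.colLen_eq hm hmk), h.part_outer hn, h.part_inner hm hmk hn]
  exact filter_map_range_min (Nat.succ_pos _) hm hn
end

section
/- Let 1 ≤ ℓ ≤ k, let □ = (ℓ^{k−ℓ+1}), and let μ be a partition with at most k−ℓ parts, each part at most ℓ−1. Let (□,μ) denote the concatenation (ℓ,…,ℓ,μ₁,…,μ_{ℓ(μ)}) with k−ℓ+1 parts equal to ℓ followed by the parts of μ. Then the k-skew diagram of (□,μ) equals the skew diagram whose outer shape is (ℓ+μ₁, …, ℓ+μ_{k−ℓ+1}, μ₁, …, μ_{ℓ(μ)}) (where μ is padded with zeros to length k−ℓ+1) and whose inner shape is μ; consequently (□,μ)^{ω_k} = (□′, μ′), the concatenation of □′ = ((k−ℓ+1)^ℓ) with the ordinary conjugate μ′ of μ. -/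
open Finset in
theorem card_filter_range_add (n m : ℕ) (hmn : m ≤ n) (P : ℕ → Prop) [DecidablePred P]
    (hP : ∀ t, m ≤ t → ¬ P (n + t)) :
    #{i ∈ range (n + m) | P i} =
      ∑ t ∈ range n, ((if P t then 1 else 0) + if P (n + t) then 1 else 0) := by
  rw [card_filter, sum_range_add, sum_add_distrib]
  congr 1
  refine sum_subset (range_mono hmn) fun t _ ht => ?_
  rw [if_neg (hP t (by simpa using ht))]

theorem part_of_lt {l : List ℕ} {i : ℕ} (h : i < l.length) : part l i = l[i] := by
  simp [part, h]

theorem part_of_le {l : List ℕ} {i : ℕ} (h : l.length ≤ i) : part l i = 0 := by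
  simp [part, h]

theorem part_append_left {l r : List ℕ} {i : ℕ} (h : i < l.length) :
    part (l ++ r) i = part l i := by
  exact List.getD_append _ _ _ _ h

theorem part_append_right {l r : List ℕ} {i : ℕ} (h : l.length ≤ i) :
    part (l ++ r) i = part r (i - l.length) := by
  exact List.getD_append_right _ _ _ _ h

theorem lt_length_of_part_pos {l : List ℕ} {i : ℕ} (h : 0 < part l i) : i < l.length := by
  by_contra! hi
  simp [part_of_le hi] at h

theorem IsPartition.part_pos {l : List ℕ} (hl : IsPartition l) {i : ℕ} (h : i < l.length) :
    0 < part l i := by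
  rw [part_of_lt h]
  exact hl.2 _ (List.getElem_mem h)

theorem IsPartition.part_antitone {l : List ℕ} (hl : IsPartition l) : Antitone (part l) := by
  intro i j hij
  rcases le_or_gt l.length j with hj | hj
  · simp [part_of_le hj]
  · rcases hij.eq_or_lt with rfl | hlt
    · rfl
    · rw [part_of_lt hj, part_of_lt (hlt.trans hj)]
      exact List.pairwise_iff_getElem.1 hl.1 _ _ _ _ hlt

theorem IsPartition.ext_part {l m : List ℕ} (hl : IsPartition l) (hm : IsPartition m)
    (h : ∀ i, part l i = part m i) : l = m := by
  have hlen : l.length = m.length := by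
    apply le_antisymm <;> by_contra! hlt
    · have := hl.part_pos hlt
      rw [h, part_of_le le_rfl] at this
      omega
    · have := hm.part_pos hlt
      rw [← h, part_of_le le_rfl] at this
      omega
  refine List.ext_getElem hlen fun i h₁ h₂ => ?_
  rw [← part_of_lt h₁, ← part_of_lt h₂, h]

theorem hookLen_eq_of_part_eq {o n o' n' : List ℕ} {i j : ℕ}
    (ho : ∀ t, i < t → part o t = part o' t) (hn : ∀ t, i < t → part n t = part n' t)
    (harm : part o i - max j (part n i) = part o' i - max j (part n' i)) :
    hookLen o n i j = hookLen o' n' i j := by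
  unfold hookLen
  rw [card_arm, card_arm, harm]
  congr 2
  ext t
  simp only [Finset.mem_filter, Finset.mem_range]
  constructor
  · rintro ⟨-, h₁, h₂, h₃⟩
    rw [hn t h₁] at h₂
    rw [ho t h₁] at h₃
    exact ⟨lt_length_of_part_pos (by omega), h₁, h₂, h₃⟩
  · rintro ⟨-, h₁, h₂, h₃⟩
    rw [← hn t h₁] at h₂
    rw [← ho t h₁] at h₃
    exact ⟨lt_length_of_part_pos (by omega), h₁, h₂, h₃⟩

/-- Above the rows of the partition, a `k`-skew diagram has no squares. -/
theorem IsKSkew.part_outer_eq_zero {k : ℕ} {l o n : List ℕ} (h : IsKSkew k l o n) {i : ℕ}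
    (hi : l.length ≤ i) : part o i = 0 := by
  obtain ⟨-, -, hsub, hrow, -, hin⟩ := h
  have heq : ∀ t, i ≤ t → part o t = part n t := fun t ht => by
    have h₁ := hrow t
    have h₂ := hsub t
    rw [part_of_le (hi.trans ht)] at h₁
    omega
  by_contra hne
  have hh := hin i 0 (by have := heq i le_rfl; omega)
  have hz : hookLen o n i 0 = 0 := by
    unfold hookLen
    rw [card_arm, heq i le_rfl, Nat.zero_max, Nat.sub_self, Nat.zero_add, Finset.card_eq_zero,
      Finset.filter_eq_empty_iff]
    rintro t - ⟨h₁, h₂, h₃⟩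
    rw [heq t h₁.le] at h₃
    omega
  omega

theorem IsKSkew.not_part_inner_lt {k : ℕ} {l o n o' n' : List ℕ} (hl : IsPartition l)
    (h : IsKSkew k l o n) (h' : IsKSkew k l o' n') {i : ℕ} (hi : i < l.length)
    (ho : ∀ t, i < t → part o t = part o' t) (hn : ∀ t, i < t → part n t = part n' t) :
    ¬ part n i < part n' i := by
  intro hlt
  have hpos := hl.part_pos hi
  have h₁ := h.2.2.2.1 i
  have h₂ := h'.2.2.2.1 i
  have hle := h.2.2.2.2.1 i (part n i) le_rfl (by omega)
  have hgt := h'.2.2.2.2.2 i (part n i) hlt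
  rw [hookLen_eq_of_part_eq ho hn (by rw [max_self, max_eq_right hlt.le, h₁, h₂])] at hle
  omega

theorem IsKSkew.unique {k : ℕ} {l o n o' n' : List ℕ} (hl : IsPartition l)
    (h : IsKSkew k l o n) (h' : IsKSkew k l o' n') : o = o' ∧ n = n' := by
  have key : ∀ d i, l.length ≤ i + d → part o i = part o' i ∧ part n i = part n' i := by
    intro d
    induction d with
    | zero =>
      intro i hi
      have h₁ := h.part_outer_eq_zero (i := i) hi
      have h₂ := h'.part_outer_eq_zero (i := i) hi
      have h₃ := h.2.2.1 i
      have h₄ := h'.2.2.1 i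
      omega
    | succ d ih =>
      intro i hi
      rcases le_or_gt l.length (i + d) with hd | hd
      · exact ih i hd
      have ho : ∀ t, i < t → part o t = part o' t := fun t ht => (ih t (by omega)).1
      have hn : ∀ t, i < t → part n t = part n' t := fun t ht => (ih t (by omega)).2
      have h₁ := IsKSkew.not_part_inner_lt hl h h' (i := i) (by omega) ho hn
      have h₂ := IsKSkew.not_part_inner_lt hl h' h (i := i) (by omega)
        (fun t ht => (ho t ht).symm) (fun t ht => (hn t ht).symm)
      have h₃ := h.2.2.2.1 i
      have h₄ := h'.2.2.2.1 i
      have h₅ := h.2.2.1 i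
      have h₆ := h'.2.2.1 i
      omega
  exact ⟨h.1.ext_part h'.1 fun i => (key l.length i (by omega)).1,
    h.2.1.ext_part h'.2.1 fun i => (key l.length i (by omega)).2⟩

theorem kConj_eq_skewCols {k : ℕ} {l o n : List ℕ} (hl : IsPartition l) (h : IsKSkew k l o n) :
    kConj k l = skewCols o n := by
  have hex : ∃ p : List ℕ × List ℕ, IsKSkew k l p.1 p.2 := ⟨(o, n), h⟩
  obtain ⟨h₁, h₂⟩ := IsKSkew.unique hl hex.choose_spec h
  rw [kConj, dif_pos hex, h₁, h₂]

theorem length_filter_lt (l : List ℕ) (j : ℕ) :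
    (l.filter (fun x => decide (j < x))).length =
      ∑ t ∈ Finset.range l.length, if j < part l t then 1 else 0 := by
  induction l with
  | nil => simp
  | cons a l ih =>
    rw [List.length_cons, Finset.sum_range_succ']
    have hsucc : ∀ t, part (a :: l) (t + 1) = part l t := fun _ => rfl
    have hzero : part (a :: l) 0 = a := rfl
    simp only [hsucc, hzero]
    rw [← ih, List.filter_cons]
    by_cases h : j < a <;> simp [h]

section RectangleConcat

variable {n ℓ : ℕ} {μ : List ℕ}

/-- The outer shape `(□ + μ, μ)`, where `□` is the rectangle with `n` rows of length `ℓ`. -/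
def rectOuter (n ℓ : ℕ) (μ : List ℕ) : List ℕ :=
  (List.range n).map (fun i => ℓ + part μ i) ++ μ

theorem length_rectOuter : (rectOuter n ℓ μ).length = n + μ.length := by
  simp [rectOuter]

theorem part_rectOuter_of_lt {i : ℕ} (h : i < n) : part (rectOuter n ℓ μ) i = ℓ + part μ i := by
  rw [rectOuter, part_append_left (by simpa using h), part_of_lt (by simpa using h)]
  simp

theorem part_rectOuter_add (t : ℕ) : part (rectOuter n ℓ μ) (n + t) = part μ t := by
  rw [rectOuter, part_append_right (by simp)]
  simp

theorem isPartition_rectOuter (hℓ : 1 ≤ ℓ) (hμ : IsPartition μ) (hparts : ∀ x ∈ μ, x ≤ ℓ - 1) :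
    IsPartition (rectOuter n ℓ μ) := by
  refine ⟨?_, ?_⟩
  · rw [rectOuter, List.pairwise_append, List.pairwise_map]
    refine ⟨List.pairwise_lt_range.imp fun h => ?_, hμ.1, ?_⟩
    · exact Nat.add_le_add_left (hμ.part_antitone h.le) _
    · intro a ha x hx
      obtain ⟨i, -, rfl⟩ := List.mem_map.1 ha
      have := hparts x hx
      omega
  · intro x hx
    rcases List.mem_append.1 hx with ha | hx
    · obtain ⟨i, -, rfl⟩ := List.mem_map.1 ha
      omega
    · exact hμ.2 x hx

theorem isPartition_replicate_append (hℓ : 1 ≤ ℓ) (hμ : IsPartition μ)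
    (hparts : ∀ x ∈ μ, x ≤ ℓ - 1) : IsPartition (List.replicate n ℓ ++ μ) := by
  refine ⟨?_, ?_⟩
  · rw [List.pairwise_append]
    refine ⟨List.pairwise_replicate.2 (Or.inr le_rfl), hμ.1, ?_⟩
    intro a ha x hx
    have := hparts x hx
    have := List.eq_of_mem_replicate ha
    omega
  · intro x hx
    rcases List.mem_append.1 hx with ha | hx
    · have := List.eq_of_mem_replicate ha
      omega
    · exact hμ.2 x hx

theorem part_lt_of_forall_mem_le (hℓ : 1 ≤ ℓ) (hparts : ∀ x ∈ μ, x ≤ ℓ - 1) (i : ℕ) :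
    part μ i < ℓ := by
  rcases le_or_gt μ.length i with h | h
  · rw [part_of_le h]
    omega
  · have := hparts _ (List.getElem_mem h)
    rw [part_of_lt h]
    omega

/-- Counting cells of a column of `(□ + μ, μ)/μ` in pairs of rows `t`, `n + t`. -/
theorem card_column_rectOuter (hlen : μ.length ≤ n) (Q : ℕ → Prop) [DecidablePred Q] (j : ℕ) :
    ((Finset.range (rectOuter n ℓ μ).length).filter
      (fun i => Q i ∧ part μ i ≤ j ∧ j < part (rectOuter n ℓ μ) i)).card =
    ∑ t ∈ Finset.range n, ((if Q t ∧ part μ t ≤ j ∧ j < ℓ + part μ t then 1 else 0) +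
      if Q (n + t) ∧ j < part μ t then 1 else 0) := by
  rw [length_rectOuter, card_filter_range_add _ _ hlen]
  · refine Finset.sum_congr rfl fun t ht => ?_
    rw [part_rectOuter_of_lt (Finset.mem_range.1 ht), part_rectOuter_add,
      part_of_le (i := n + t) (by omega)]
    simp
  · rintro t ht ⟨-, -, h⟩
    rw [part_rectOuter_add, part_of_le ht] at h
    omega

theorem hookLen_rectOuter (hlen : μ.length ≤ n) (i j : ℕ) :
    hookLen (rectOuter n ℓ μ) μ i j =
      (part (rectOuter n ℓ μ) i - max j (part μ i)) +
      ∑ t ∈ Finset.range n, ((if i < t ∧ part μ t ≤ j ∧ j < ℓ + part μ t then 1 else 0) +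
        if i < n + t ∧ j < part μ t then 1 else 0) := by
  rw [hookLen, card_arm, card_column_rectOuter hlen (fun t => i < t)]

theorem hookLen_rectOuter_le (hn : μ.length < n) (hℓ : 1 ≤ ℓ)
    (hparts : ∀ x ∈ μ, x ≤ ℓ - 1) {i j : ℕ} (hj : part μ i ≤ j) :
    hookLen (rectOuter n ℓ μ) μ i j ≤ n - 1 + ℓ := by
  have hlt := part_lt_of_forall_mem_le hℓ hparts
  rcases lt_or_ge i n with hi | hi
  · have hsum : ∑ t ∈ Finset.range n,
        ((if i < t ∧ part μ t ≤ j ∧ j < ℓ + part μ t then 1 else 0) +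
          if i < n + t ∧ j < part μ t then 1 else 0) ≤
        ∑ t ∈ Finset.range n, if t ≠ i then 1 else 0 := by
      refine Finset.sum_le_sum fun t _ => ?_
      rcases eq_or_ne t i with rfl | hti
      · simp [hj]
      · split_ifs <;> omega
    have hcard : (∑ t ∈ Finset.range n, if t ≠ i then 1 else 0) = n - 1 := by
      rw [← Finset.card_filter, Finset.filter_ne', Finset.card_erase_of_mem (by simpa using hi),
        Finset.card_range]
    rw [hookLen_rectOuter hn.le, part_rectOuter_of_lt hi]
    omega
  · obtain ⟨s, rfl⟩ := Nat.exists_eq_add_of_le hi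
    have hsum : ∑ t ∈ Finset.range n,
        ((if n + s < t ∧ part μ t ≤ j ∧ j < ℓ + part μ t then 1 else 0) +
          if n + s < n + t ∧ j < part μ t then 1 else 0) ≤
        ∑ t ∈ Finset.range n, if t ≠ 0 then 1 else 0 := by
      refine Finset.sum_le_sum fun t ht => ?_
      rw [Finset.mem_range] at ht
      split_ifs <;> omega
    have hcard : (∑ t ∈ Finset.range n, if t ≠ 0 then 1 else 0) = n - 1 := by
      rw [← Finset.card_filter, Finset.filter_ne',
        Finset.card_erase_of_mem (by simp; omega), Finset.card_range]
    rw [hookLen_rectOuter hn.le, part_rectOuter_add]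
    have := hlt s
    omega

theorem lt_hookLen_rectOuter (hn : μ.length ≤ n) (hℓ : 1 ≤ ℓ) (hμ : IsPartition μ)
    (hparts : ∀ x ∈ μ, x ≤ ℓ - 1) {i j : ℕ} (hj : j < part μ i) :
    n + ℓ ≤ hookLen (rectOuter n ℓ μ) μ i j := by
  have hlt := part_lt_of_forall_mem_le hℓ hparts
  have hi : i < n := (lt_length_of_part_pos (by omega)).trans_le hn
  have hsum : ∑ t ∈ Finset.range n, 1 ≤ ∑ t ∈ Finset.range n,
      ((if i < t ∧ part μ t ≤ j ∧ j < ℓ + part μ t then 1 else 0) +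
        if i < n + t ∧ j < part μ t then 1 else 0) := by
    refine Finset.sum_le_sum fun t _ => ?_
    have := hlt i
    rcases le_or_gt t i with hti | hti
    · have := hμ.part_antitone hti
      split_ifs <;> omega
    · split_ifs <;> omega
  rw [Finset.sum_const, Finset.card_range, smul_eq_mul, mul_one] at hsum
  rw [hookLen_rectOuter hn, part_rectOuter_of_lt hi, max_eq_right hj.le]
  omega

theorem isKSkew_rectOuter (hn : μ.length < n) (hℓ : 1 ≤ ℓ) (hμ : IsPartition μ)
    (hparts : ∀ x ∈ μ, x ≤ ℓ - 1) :
    IsKSkew (n - 1 + ℓ) (List.replicate n ℓ ++ μ) (rectOuter n ℓ μ) μ := by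
  refine ⟨isPartition_rectOuter hℓ hμ hparts, hμ, fun i => ?_, fun i => ?_,
    fun i j hj _ => hookLen_rectOuter_le hn hℓ hparts hj, fun i j hj => ?_⟩
  · rcases lt_or_ge i n with hi | hi
    · rw [part_rectOuter_of_lt hi]
      omega
    · rw [part_of_le (hn.le.trans hi)]
      omega
  · rcases lt_or_ge i n with hi | hi
    · rw [part_rectOuter_of_lt hi, part_append_left (by simpa using hi),
        part_of_lt (l := List.replicate n ℓ) (by simpa using hi)]
      simp
    · obtain ⟨s, rfl⟩ := Nat.exists_eq_add_of_le hi
      rw [part_rectOuter_add, part_append_right (by simp), part_of_le (hn.le.trans hi)]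
      simp
  · have := lt_hookLen_rectOuter hn.le hℓ hμ hparts hj
    omega

theorem colLen_rectOuter (hn : μ.length ≤ n) (j : ℕ) :
    colLen (rectOuter n ℓ μ) μ j =
      ∑ t ∈ Finset.range n, ((if part μ t ≤ j ∧ j < ℓ + part μ t then 1 else 0) +
        if j < part μ t then 1 else 0) := by
  simpa [colLen] using card_column_rectOuter (ℓ := ℓ) hn (fun _ => True) j

theorem colLen_rectOuter_of_lt (hn : μ.length ≤ n) {j : ℕ} (hj : j < ℓ) :
    colLen (rectOuter n ℓ μ) μ j = n := by
  rw [colLen_rectOuter hn]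
  trans ∑ t ∈ Finset.range n, 1
  · refine Finset.sum_congr rfl fun t _ => ?_
    split_ifs <;> omega
  · simp

theorem colLen_rectOuter_add (hn : μ.length ≤ n) (hℓ : 1 ≤ ℓ) (hparts : ∀ x ∈ μ, x ≤ ℓ - 1)
    (j : ℕ) :
    colLen (rectOuter n ℓ μ) μ (ℓ + j) = (μ.filter (fun x => decide (j < x))).length := by
  have hlt := part_lt_of_forall_mem_le hℓ hparts
  rw [colLen_rectOuter hn, length_filter_lt]
  symm
  trans ∑ t ∈ Finset.range n, if j < part μ t then 1 else 0
  · refine Finset.sum_subset (Finset.range_mono hn) fun t _ ht => ?_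
    rw [part_of_le (by simpa using ht)]
    simp
  · refine Finset.sum_congr rfl fun t _ => ?_
    have := hlt t
    split_ifs <;> omega

theorem skewCols_rectOuter (hn : μ.length < n) (hℓ : 1 ≤ ℓ) (hparts : ∀ x ∈ μ, x ≤ ℓ - 1) :
    skewCols (rectOuter n ℓ μ) μ = List.replicate ℓ n ++ conj μ := by
  have hmap : (List.range (ℓ + part μ 0)).map (colLen (rectOuter n ℓ μ) μ) =
      List.replicate ℓ n ++ conj μ := by
    rw [List.range_add, List.map_append, List.map_map]
    congr 1
    · rw [List.eq_replicate_iff]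
      refine ⟨by simp, fun b hb => ?_⟩
      obtain ⟨j, hj, rfl⟩ := List.mem_map.1 hb
      exact colLen_rectOuter_of_lt hn.le (List.mem_range.1 hj)
    · exact List.map_congr_left fun j _ => colLen_rectOuter_add hn.le hℓ hparts j
  rw [skewCols, part_rectOuter_of_lt (by omega), hmap, List.filter_eq_self]
  intro x hx
  rw [decide_eq_true_iff]
  rcases List.mem_append.1 hx with hx | hx
  · have := List.eq_of_mem_replicate hx
    omega
  · obtain ⟨j, hj, rfl⟩ := List.mem_map.1 hx
    rw [List.mem_range] at hj
    have hpos : 0 < μ.length := lt_length_of_part_pos (by omega)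
    rw [part_of_lt hpos] at hj
    exact (List.length_pos_of_mem
      (List.mem_filter.2 ⟨List.getElem_mem hpos, decide_eq_true hj⟩)).ne'

end RectangleConcat

/-- the `k`-skew diagram of `(□, μ)` with `□ = (ℓ^{k-ℓ+1})` and
`μ ⊆ ((ℓ-1)^{k-ℓ})` is `(□+μ, μ)/μ`, and consequently `(□,μ)^{ω_k} = (□', μ')`. -/
theorem kSkew_rectangle_concat (k ℓ : ℕ) (hℓ : 1 ≤ ℓ) (hℓk : ℓ ≤ k) (μ : List ℕ)
    (hμ : IsPartition μ) (hlen : μ.length ≤ k - ℓ) (hparts : ∀ x ∈ μ, x ≤ ℓ - 1) :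
    IsKSkew k (List.replicate (k - ℓ + 1) ℓ ++ μ)
      ((List.range (k - ℓ + 1)).map (fun i => ℓ + part μ i) ++ μ) μ ∧
    kConj k (List.replicate (k - ℓ + 1) ℓ ++ μ) =
      List.replicate ℓ (k - ℓ + 1) ++ conj μ := by
  have h := isKSkew_rectOuter (n := k - ℓ + 1) (by omega) hℓ hμ hparts
  rw [show k - ℓ + 1 - 1 + ℓ = k by omega] at h
  refine ⟨h, ?_⟩
  rw [kConj_eq_skewCols (isPartition_replicate_append hℓ hμ hparts) h]
  exact skewCols_rectOuter (by omega) hℓ hparts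
end

section
/- For any k-bounded partitions λ and μ and any k-rectangle □: (λ ∪ □) ≼ μ in the k-Young order if and only if there exists a k-bounded partition μ̄ such that μ = μ̄ ∪ □ and λ ≼ μ̄. -/
/-! ### Lists as partitions -/

@[simp] theorem part_nil (i : ℕ) : part [] i = 0 := rfl

@[simp] theorem part_cons_zero (a : ℕ) (l : List ℕ) : part (a :: l) 0 = a := rfl

@[simp] theorem part_cons_succ (a : ℕ) (l : List ℕ) (i : ℕ) :
    part (a :: l) (i + 1) = part l i := rfl

@[simp] theorem part_tail (l : List ℕ) (i : ℕ) : part l.tail i = part l (i + 1) := by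
  cases l <;> rfl

theorem isPartition_nil : IsPartition [] := by simp [IsPartition]

theorem isPartition_cons {a : ℕ} {l : List ℕ} :
    IsPartition (a :: l) ↔ 0 < a ∧ part l 0 ≤ a ∧ IsPartition l := by
  cases l with
  | nil => simp [IsPartition]
  | cons b l =>
    simp only [IsPartition, List.pairwise_cons, List.mem_cons, forall_eq_or_imp, part_cons_zero]
    constructor
    · tauto
    · rintro ⟨ha, hb, ⟨h1, h2⟩, h3, h4⟩
      exact ⟨⟨⟨hb, fun x hx => (h1 x hx).trans hb⟩, h1, h2⟩, ha, h3, h4⟩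

theorem IsPartition.le_part_zero {l : List ℕ} (h : IsPartition l) : ∀ x ∈ l, x ≤ part l 0 := by
  cases l with
  | nil => simp
  | cons b l =>
    have := (List.pairwise_cons.1 h.1).1
    simpa using this

theorem kBounded_iff {k : ℕ} {l : List ℕ} :
    KBounded k l ↔ l.Pairwise (· ≥ ·) ∧ (∀ x ∈ l, 0 < x) ∧ ∀ x ∈ l, x ≤ k := by
  constructor
  · exact fun h => ⟨h.1.1, h.1.2, fun x hx => (h.1.le_part_zero x hx).trans h.2⟩
  · rintro ⟨h1, h2, h3⟩
    refine ⟨⟨h1, h2⟩, ?_⟩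
    cases l with
    | nil => simp
    | cons b l => exact h3 b (by simp)

theorem KBounded.sublist {k : ℕ} {l m : List ℕ} (h : KBounded k m) (hl : l.Sublist m) :
    KBounded k l := by
  rw [kBounded_iff] at h ⊢
  exact ⟨h.1.sublist hl, fun x hx => h.2.1 x (hl.subset hx), fun x hx => h.2.2 x (hl.subset hx)⟩

theorem kBounded_cons {k a : ℕ} {l : List ℕ} (h : KBounded k (a :: l)) :
    0 < a ∧ a ≤ k ∧ (∀ x ∈ l, x ≤ a) ∧ KBounded k l :=
  ⟨h.1.2 a (by simp), h.2, (List.pairwise_cons.1 h.1.1).1, h.sublist (List.sublist_cons_self a l)⟩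

theorem lt_part_iff {l : List ℕ} (h : l.Pairwise (· ≥ ·)) (t i : ℕ) :
    t < part l i ↔ i < l.countP (fun x => decide (t < x)) := by
  induction l generalizing i with
  | nil => simp
  | cons a l ih =>
    obtain ⟨ha, hl⟩ := List.pairwise_cons.1 h
    by_cases hta : t < a
    · cases i <;> simp [hta, ih hl]
    · have h0 : l.countP (fun x => decide (t < x)) = 0 := by
        rw [List.countP_eq_zero]
        intro x hx
        have := ha x hx
        simp; omega
      cases i with
      | zero => simp [hta, h0]
      | succ i => simp [hta, h0, ih hl]

theorem subDiag_of_lt_part_iff {l m : List ℕ} {f g : ℕ → ℕ}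
    (hf : ∀ t j, t < part l j ↔ j < f t) (hg : ∀ t j, t < part m j ↔ j < g t) :
    SubDiag l m ↔ ∀ t, f t ≤ g t := by
  constructor
  · intro h t
    by_contra! hlt
    have h1 := (hf t (g t)).2 hlt
    have h2 := (hg t (g t)).1 (h1.trans_le (h _))
    omega
  · intro h j
    by_contra! hlt
    have h1 := (hf _ j).1 hlt
    have h2 := (hg _ j).2 (h1.trans_le (h _))
    omega

theorem subDiag_iff_countP {l m : List ℕ} (hl : l.Pairwise (· ≥ ·)) (hm : m.Pairwise (· ≥ ·)) :
    SubDiag l m ↔ ∀ t, l.countP (fun x => decide (t < x)) ≤ m.countP (fun x => decide (t < x)) :=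
  subDiag_of_lt_part_iff (lt_part_iff hl) (lt_part_iff hm)

theorem sum_eq_sum_countP {M : ℕ} {l : List ℕ} (h : ∀ x ∈ l, x ≤ M) :
    l.sum = ∑ t ∈ Finset.range M, l.countP (fun x => decide (t < x)) := by
  induction l with
  | nil => simp
  | cons a l ih =>
    have ha : a ≤ M := h a (by simp)
    have hc : ∑ t ∈ Finset.range M, (if t < a then 1 else 0) = a := by
      rw [← Finset.card_filter]
      have : (Finset.range M).filter (fun t => t < a) = Finset.range a := by
        ext t; simp; omega
      simp [this]
    simp only [List.sum_cons, List.countP_cons, decide_eq_true_eq, Finset.sum_add_distrib]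
    rw [hc, ih fun x hx => h x (by simp [hx])]
    omega

theorem countP_lt_eq_count_add (l : List ℕ) (x : ℕ) :
    l.countP (fun y => decide (x ≤ y)) = l.count x + l.countP (fun y => decide (x < y)) := by
  induction l with
  | nil => simp
  | cons a l ih =>
    simp only [List.countP_cons, List.count_cons, ih, decide_eq_true_eq, beq_iff_eq]
    split_ifs <;> omega

/-! ### Column counts of the `k`-skew diagram -/

/-- `colCount k l t` is the number of columns of length exceeding `t` in the `k`-skew diagram
of `l`: putting a row of length `a` below a diagram rotates the first `k - a + 1` of these
numbers. -/
def colCount (k : ℕ) : List ℕ → ℕ → ℕ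
  | [], _ => 0
  | a :: l, t =>
    if k < t + a then colCount k l t
    else if t = 0 then colCount k l (k - a) + a
    else colCount k l (t - 1)

theorem colCount_zero_le_of_antitone {k b : ℕ} (hb : b ≤ k) {l : List ℕ} (hl : ∀ x ∈ l, x ≤ b)
    (h : ∀ m, m.Sublist l → Antitone (colCount k m)) :
    colCount k l 0 ≤ colCount k l (k - b) + b := by
  cases l with
  | nil => simp [colCount]
  | cons a l =>
    have ha : a ≤ b := hl a (by simp)
    have hant := h l (List.sublist_cons_self a l)
    have h1 : colCount k l (k - a) ≤ colCount k l (k - b - 1) := hant (by omega)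
    simp only [colCount]
    split_ifs <;> omega

theorem colCount_antitone {k : ℕ} {l : List ℕ} (h : KBounded k l) : Antitone (colCount k l) := by
  suffices H : ∀ l, KBounded k l → ∀ m, m.Sublist l → Antitone (colCount k m) from
    H l h l (List.Sublist.refl l)
  clear h l
  intro l
  induction l with
  | nil =>
    intro _ m hm
    rw [List.sublist_nil.1 hm]
    exact fun _ _ _ => le_rfl
  | cons a l ih =>
    intro hl m hm
    obtain ⟨_, hak, hla, hlk⟩ := kBounded_cons hl
    rcases List.sublist_cons_iff.1 hm with hm | ⟨r, rfl, hr⟩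
    · exact ih hlk m hm
    · have hra : ∀ x ∈ r, x ≤ a := fun x hx => hla x (hr.subset hx)
      have h0 := colCount_zero_le_of_antitone hak hra fun m hm => ih hlk m (hm.trans hr)
      have hant := ih hlk r hr
      refine antitone_nat_of_succ_le fun t => ?_
      have h1 : colCount k r (t + 1) ≤ colCount k r t := hant (by omega)
      have h2 : colCount k r t ≤ colCount k r (t - 1) := hant (by omega)
      have h3 : colCount k r t ≤ colCount k r 0 := hant (by omega)
      simp only [colCount, Nat.add_sub_cancel, Nat.add_eq_zero_iff, one_ne_zero, and_false,
        if_false]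
      split_ifs <;> omega

theorem colCount_zero_le {k b : ℕ} (hb : b ≤ k) {l : List ℕ} (hl : KBounded k l)
    (hlb : ∀ x ∈ l, x ≤ b) : colCount k l 0 ≤ colCount k l (k - b) + b :=
  colCount_zero_le_of_antitone hb hlb fun _ hm => colCount_antitone (hl.sublist hm)

/-! ### Adding a bottom row to a skew diagram -/

theorem colLen_cons (o : ℕ) (O I : List ℕ) (j : ℕ) :
    colLen (o :: O) I j = colLen O I.tail j + if part I 0 ≤ j ∧ j < o then 1 else 0 := by
  simp only [colLen, Finset.card_filter, List.length_cons, Finset.sum_range_succ',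
    part_cons_succ, part_cons_zero, part_tail]
  rfl

theorem hookLen_cons_succ (o : ℕ) (O I : List ℕ) (i j : ℕ) :
    hookLen (o :: O) I (i + 1) j = hookLen O I.tail i j := by
  simp only [hookLen, Finset.card_filter, List.length_cons,
    Finset.sum_range_succ', part_cons_succ, part_tail, Nat.add_lt_add_iff_right, Nat.not_lt_zero,
    false_and, if_false, Nat.add_zero]

theorem hookLen_cons_zero (o : ℕ) (O I : List ℕ) (j : ℕ) :
    hookLen (o :: O) I 0 j = (o - max j (part I 0)) + colLen O I.tail j := by
  have h1 : (Finset.range o).filter (fun j' => j ≤ j' ∧ part I 0 ≤ j') =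
      Finset.Ico (max j (part I 0)) o := by
    ext x; simp; omega
  simp only [hookLen, part_cons_zero, h1, Nat.card_Ico, colLen, Finset.card_filter,
    List.length_cons, Finset.sum_range_succ', part_cons_succ, part_tail, Nat.succ_pos, true_and,
    lt_irrefl, false_and, if_false, Nat.add_zero]

theorem IsPartition.tail {l : List ℕ} (h : IsPartition l) : IsPartition l.tail := by
  cases l with
  | nil => exact h
  | cons a l => exact (isPartition_cons.1 h).2.2

theorem IsKSkew.tail {k a o : ℕ} {l O I : List ℕ} (h : IsKSkew k (a :: l) (o :: O) I) :
    IsKSkew k l O I.tail := by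
  obtain ⟨h1, h2, h3, h4, h5, h6⟩ := h
  refine ⟨h1.tail, h2.tail, fun i => ?_, fun i => ?_, fun i j => ?_, fun i j => ?_⟩
  · simpa using h3 (i + 1)
  · simpa using h4 (i + 1)
  · simpa [hookLen_cons_succ] using h5 (i + 1) j
  · simpa [hookLen_cons_succ] using h6 (i + 1) j

theorem IsKSkew.outer_eq_nil {k : ℕ} {O I : List ℕ} (h : IsKSkew k [] O I) : O = [] := by
  obtain ⟨h1, -, h3, h4, -, h6⟩ := h
  by_contra hne
  have hlen := List.length_pos_iff.2 hne
  have hpos : 0 < part O (O.length - 1) := by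
    have hlt : O.length - 1 < O.length := by omega
    simp only [part, List.getD_eq_getElem _ _ hlt]
    exact h1.2 _ (List.getElem_mem hlt)
  have h4' := h4 (O.length - 1)
  have h3' := h3 (O.length - 1)
  rw [part_nil] at h4'
  have hh := h6 (O.length - 1) 0 (by omega)
  have e1 : (Finset.range (part O (O.length - 1))).filter
      (fun j' => 0 ≤ j' ∧ part I (O.length - 1) ≤ j') = ∅ := by
    ext x; simp; omega
  have e2 : (Finset.range O.length).filter
      (fun i' => O.length - 1 < i' ∧ part I i' ≤ 0 ∧ 0 < part O i') = ∅ := by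
    ext x; simp; omega
  rw [hookLen, e1, e2] at hh
  simp at hh

theorem IsKSkew.lt_colLen_iff {k : ℕ} {l O I : List ℕ} (hl : KBounded k l)
    (h : IsKSkew k l O I) :
    part O 0 = colCount k l 0 ∧ ∀ t j, t < colLen O I j ↔ j < colCount k l t := by
  induction l generalizing O I with
  | nil => simp [h.outer_eq_nil, colCount, colLen]
  | cons a l ih =>
    obtain ⟨ha, hak, hla, hlk⟩ := kBounded_cons hl
    cases O with
    | nil =>
      have := h.2.2.2.1 0
      simp at this
      omega
    | cons o O =>
      obtain ⟨-, hc⟩ := ih hlk h.tail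
      obtain ⟨-, -, h3, h4, h5, h6⟩ := h
      have h40 := h4 0
      have h30 := h3 0
      simp only [part_cons_zero] at h40 h30
      have hx : part I 0 = colCount k l (k - a) := by
        apply le_antisymm
        · by_contra! hlt
          have := h6 0 _ hlt
          rw [hookLen_cons_zero] at this
          have := (hc (k - a) (colCount k l (k - a))).1 (by omega)
          omega
        · by_contra! hlt
          have := h5 0 _ le_rfl (by simp only [part_cons_zero]; omega)
          rw [hookLen_cons_zero] at this
          have := (hc (k - a) _).2 hlt
          omega
      have hs := colCount_zero_le hak hlk hla
      have hant := colCount_antitone hlk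
      refine ⟨by simp [colCount, hak.not_gt]; omega, fun t j => ?_⟩
      rw [colLen_cons]
      have c1 := hc t j
      have c2 := hc (t - 1) j
      have c3 := hc (k - a) j
      have c4 : colCount k l (t - 1) ≤ colCount k l 0 := hant (by omega)
      have c5 : t ≤ k - a → colCount k l (k - a) ≤ colCount k l t := fun h => hant h
      have c6 : k - a ≤ t → colCount k l t ≤ colCount k l (k - a) := fun h => hant h
      have c7 : colCount k l t ≤ colCount k l (t - 1) := hant (by omega)
      simp only [colCount]
      rw [← hx] at *
      rcases Nat.eq_zero_or_pos t with rfl | ht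
      · split_ifs <;> omega
      · split_ifs <;> omega

/-! ### Existence of the `k`-skew diagram -/

/-- The outer shape of the `k`-skew diagram. -/
def outerShape (k : ℕ) : List ℕ → List ℕ
  | [] => []
  | a :: l => (colCount k l (k - a) + a) :: outerShape k l

/-- The inner shape of the `k`-skew diagram. -/
def innerShape (k : ℕ) : List ℕ → List ℕ
  | [] => []
  | a :: l => if colCount k l (k - a) = 0 then [] else colCount k l (k - a) :: innerShape k l

theorem part_innerShape_cons_zero (k a : ℕ) (l : List ℕ) :
    part (innerShape k (a :: l)) 0 = colCount k l (k - a) := by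
  simp only [innerShape]
  split_ifs with h <;> simp [h]

theorem part_innerShape_zero_le {k a : ℕ} {l : List ℕ} (h : KBounded k (a :: l)) :
    part (innerShape k l) 0 ≤ colCount k l (k - a) := by
  obtain ⟨-, hak, hla, hlk⟩ := kBounded_cons h
  cases l with
  | nil => simp [innerShape]
  | cons b l =>
    rw [part_innerShape_cons_zero]
    have hb := hla b (by simp)
    have : colCount k l (k - b) ≤ colCount k l (k - a - 1) :=
      colCount_antitone (kBounded_cons hlk).2.2.2 (by omega)
    simp only [colCount]
    split_ifs <;> omega

theorem isKSkew_outerShape_innerShape {k : ℕ} {l : List ℕ} (h : KBounded k l) :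
    IsKSkew k l (outerShape k l) (innerShape k l) := by
  induction l with
  | nil => simp [IsKSkew, outerShape, innerShape, isPartition_nil, SubDiag]
  | cons a l ih =>
    obtain ⟨ha, hak, hla, hlk⟩ := kBounded_cons h
    have hI := part_innerShape_zero_le h
    have hs := ih hlk
    obtain ⟨hO, hc⟩ := hs.lt_colLen_iff hlk
    obtain ⟨h1, h2, h3, h4, h5, h6⟩ := hs
    have hS := colCount_zero_le hak hlk hla
    have hx := part_innerShape_cons_zero k a l
    have htail : (innerShape k (a :: l)).tail = innerShape k l := by
      rw [innerShape]
      split_ifs with h0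
      · rw [h0] at hI
        generalize innerShape k l = J at *
        cases J with
        | nil => rfl
        | cons b J =>
          have := (isPartition_cons.1 h2).1
          simp at hI
          omega
      · rfl
    have hpI : ∀ i, part (innerShape k (a :: l)) (i + 1) = part (innerShape k l) i := fun i => by
      rw [← part_tail, htail]
    refine ⟨?_, ?_, fun i => ?_, fun i => ?_, fun i j => ?_, fun i j => ?_⟩
    · rw [outerShape, isPartition_cons]
      exact ⟨by omega, by omega, h1⟩
    · rw [innerShape]
      split_ifs with h0
      · exact isPartition_nil
      · exact isPartition_cons.2 ⟨by omega, hI, h2⟩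
    · cases i with
      | zero => rw [hx, outerShape, part_cons_zero]; omega
      | succ i => rw [hpI, outerShape]; exact h3 i
    · cases i with
      | zero => rw [hx, outerShape, part_cons_zero, part_cons_zero]; omega
      | succ i => rw [hpI, outerShape]; exact h4 i
    · cases i with
      | zero =>
        rw [hx, outerShape, part_cons_zero, hookLen_cons_zero, hx, htail]
        have := hc (k - a) j
        omega
      | succ i => rw [hpI, outerShape, hookLen_cons_succ, htail]; exact h5 i j
    · cases i with
      | zero =>
        rw [hx, outerShape, hookLen_cons_zero, hx, htail]
        have := hc (k - a) j
        omega
      | succ i => rw [hpI, outerShape, hookLen_cons_succ, htail]; exact h6 i j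

theorem lt_part_kConj_iff {k : ℕ} {l : List ℕ} (hl : KBounded k l) (t j : ℕ) :
    t < part (kConj k l) j ↔ j < colCount k l t := by
  have hex : ∃ p : List ℕ × List ℕ, IsKSkew k l p.1 p.2 :=
    ⟨(_, _), isKSkew_outerShape_innerShape hl⟩
  obtain ⟨hO, hc⟩ := hex.choose_spec.lt_colLen_iff hl
  rw [kConj, dif_pos hex]
  generalize hex.choose = p at *
  have hfilter : skewCols p.1 p.2 = (List.range (part p.1 0)).map (colLen p.1 p.2) := by
    rw [skewCols, List.filter_eq_self]
    intro x hx
    obtain ⟨i, hi, rfl⟩ := List.mem_map.1 hx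
    have := (hc 0 i).2 (by rw [← hO]; exact List.mem_range.1 hi)
    simp; omega
  have h0 : colCount k l t ≤ colCount k l 0 := colCount_antitone hl (Nat.zero_le t)
  rw [hfilter, part]
  by_cases hj : j < part p.1 0
  · rw [List.getD_eq_getElem _ _ (by simpa using hj)]
    simpa using hc t j
  · rw [List.getD_eq_default _ _ (by simpa using hj)]
    omega

theorem subDiag_kConj_iff {k : ℕ} {l m : List ℕ} (hl : KBounded k l) (hm : KBounded k m) :
    SubDiag (kConj k l) (kConj k m) ↔ ∀ t, colCount k l t ≤ colCount k m t :=
  subDiag_of_lt_part_iff (lt_part_kConj_iff hl) (lt_part_kConj_iff hm)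

/-! ### Union with a `k`-rectangle -/

theorem punion_perm (l r : List ℕ) : (punion l r).Perm (l ++ r) := List.mergeSort_perm _ _

theorem punion_pairwise (l r : List ℕ) : (punion l r).Pairwise (· ≥ ·) := by
  have := List.pairwise_mergeSort (le := fun a b : ℕ => decide (a ≥ b))
    (by intro a b c; simp; omega) (by intro a b; simp; omega) (l ++ r)
  simpa [punion] using this

theorem eq_of_perm_of_pairwise_ge {l m : List ℕ} (hl : l.Pairwise (· ≥ ·))
    (hm : m.Pairwise (· ≥ ·)) (h : l.Perm m) : l = m :=
  h.eq_of_pairwise (fun _ _ _ _ h1 h2 => le_antisymm h2 h1) hl hm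

theorem kBounded_punion {k : ℕ} {l r : List ℕ} (hl : KBounded k l) (hr : KBounded k r) :
    KBounded k (punion l r) := by
  rw [kBounded_iff] at *
  refine ⟨punion_pairwise l r, fun x hx => ?_, fun x hx => ?_⟩
  · rcases List.mem_append.1 ((punion_perm l r).subset hx) with h | h
    exacts [hl.2.1 x h, hr.2.1 x h]
  · rcases List.mem_append.1 ((punion_perm l r).subset hx) with h | h
    exacts [hl.2.2 x h, hr.2.2 x h]

theorem kBounded_rectangle {k ℓ : ℕ} (hℓ : 1 ≤ ℓ) (hℓk : ℓ ≤ k) (n : ℕ) :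
    KBounded k (List.replicate n ℓ) := by
  rw [kBounded_iff]
  refine ⟨by simp [List.pairwise_replicate], fun x hx => ?_, fun x hx => ?_⟩ <;>
    rw [List.eq_of_mem_replicate hx] <;> omega

theorem colCount_replicate_append {k ℓ : ℕ} (hℓk : ℓ ≤ k) (l : List ℕ) {r : ℕ}
    (hr : r ≤ k - ℓ + 1) (t : ℕ) :
    colCount k (List.replicate r ℓ ++ l) t =
      if k < t + ℓ then colCount k l t
      else if t < r then colCount k l (k - ℓ + 1 - r + t) + ℓ
      else colCount k l (t - r) := by
  induction r generalizing t with
  | zero => simp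
  | succ r ih =>
    simp only [List.replicate_succ, List.cons_append, colCount]
    rw [ih (by omega), ih (by omega), ih (by omega)]
    rcases Nat.eq_zero_or_pos t with rfl | ht
    · have e1 : k - ℓ - r = k - ℓ + 1 - (r + 1) + 0 := by omega
      split_ifs <;> first | omega | rw [e1]
    · have e1 : k - ℓ + 1 - r + (t - 1) = k - ℓ + 1 - (r + 1) + t := by omega
      have e2 : t - 1 - r = t - (r + 1) := by omega
      split_ifs <;> first | omega | rw [e1] | rw [e2]

theorem colCount_append_of_lt {k ℓ : ℕ} {A : List ℕ} (hA : ∀ x ∈ A, ℓ < x) (l : List ℕ) {t : ℕ}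
    (ht : k - ℓ ≤ t) : colCount k (A ++ l) t = colCount k l t := by
  induction A with
  | nil => rfl
  | cons a A ih =>
    have := hA a (by simp)
    have h1 : k < t + a := by omega
    simp only [List.cons_append, colCount, h1, if_true]
    exact ih fun x hx => hA x (by simp [hx])

theorem colCount_append_add {k ℓ : ℕ} {A : List ℕ} (hA : ∀ x ∈ A, ℓ < x)
    {l m : List ℕ} (h : ∀ t, colCount k m t = colCount k l t + if t < k - ℓ + 1 then ℓ else 0)
    (t : ℕ) :
    colCount k (A ++ m) t = colCount k (A ++ l) t + if t < k - ℓ + 1 then ℓ else 0 := by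
  induction A generalizing t with
  | nil => exact h t
  | cons a A ih =>
    have ha := hA a (by simp)
    have ih := ih fun x hx => hA x (by simp [hx])
    simp only [List.cons_append, colCount, ih]
    split_ifs <;> omega

theorem eq_filter_append_filter {l : List ℕ} (h : l.Pairwise (· ≥ ·)) (ℓ : ℕ) :
    l = l.filter (fun x => decide (ℓ < x)) ++ l.filter (fun x => decide (x ≤ ℓ)) := by
  induction l with
  | nil => rfl
  | cons a l ih =>
    obtain ⟨ha, hl⟩ := List.pairwise_cons.1 h
    by_cases hal : ℓ < a
    · have : ¬ a ≤ ℓ := by omega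
      simp [hal, this, ← ih hl]
    · have h1 : l.filter (fun x => decide (ℓ < x)) = [] := by
        rw [List.filter_eq_nil_iff]
        intro x hx
        have := ha x hx
        simp; omega
      have h2 := ih hl
      rw [h1, List.nil_append] at h2
      have : a ≤ ℓ := by omega
      simp [hal, this, h1, ← h2]

theorem filter_le_eq_replicate_append {l : List ℕ} (h : l.Pairwise (· ≥ ·)) (ℓ : ℕ) :
    l.filter (fun x => decide (x ≤ ℓ)) =
      List.replicate (l.count ℓ) ℓ ++ l.filter (fun x => decide (x < ℓ)) := by
  refine eq_of_perm_of_pairwise_ge (h.filter _) ?_ ?_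
  · simp only [List.pairwise_append, List.pairwise_replicate, List.mem_filter, List.mem_replicate,
      decide_eq_true_eq]
    refine ⟨by simp, h.filter _, ?_⟩
    rintro a ⟨-, rfl⟩ b ⟨-, hb⟩
    exact hb.le
  · rw [List.perm_iff_count]
    intro x
    rw [List.count_append, List.count_replicate]
    rcases lt_trichotomy x ℓ with hx | rfl | hx
    · rw [List.count_filter (by simpa using hx.le), List.count_filter (by simpa using hx)]
      simp [hx.ne']
    · rw [List.count_filter (by simp), List.count_eq_zero_of_not_mem (l := List.filter _ _) (by simp)]
      simp
    · rw [List.count_eq_zero_of_not_mem (by simp [hx]),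
        List.count_eq_zero_of_not_mem (l := List.filter _ _) (by simp [hx.le])]
      simp [hx.ne]

theorem punion_replicate {l : List ℕ} (h : l.Pairwise (· ≥ ·)) (n ℓ : ℕ) :
    punion l (List.replicate n ℓ) = l.filter (fun x => decide (ℓ < x)) ++
      (List.replicate n ℓ ++ l.filter (fun x => decide (x ≤ ℓ))) := by
  refine eq_of_perm_of_pairwise_ge (punion_pairwise _ _) ?_ ?_
  · simp only [List.pairwise_append, List.pairwise_replicate, List.mem_append, List.mem_filter,
      List.mem_replicate, decide_eq_true_eq]
    refine ⟨h.filter _, ⟨by simp, h.filter _, ?_⟩, ?_⟩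
    · rintro a ⟨-, rfl⟩ b ⟨-, hb⟩; exact hb
    · rintro a ⟨-, ha⟩ b (⟨-, rfl⟩ | ⟨-, hb⟩) <;> omega
  · refine (punion_perm _ _).trans ?_
    nth_rewrite 1 [eq_filter_append_filter h ℓ]
    rw [List.append_assoc]
    exact List.perm_append_comm.append_left _

theorem colCount_punion_rectangle {k ℓ : ℕ} (hℓk : ℓ ≤ k) {l : List ℕ} (hl : KBounded k l)
    (t : ℕ) :
    colCount k (punion l (List.replicate (k - ℓ + 1) ℓ)) t =
      colCount k l t + if t < k - ℓ + 1 then ℓ else 0 := by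
  have hlp := hl.1.1
  rw [punion_replicate hlp]
  nth_rewrite 3 [eq_filter_append_filter hlp ℓ]
  refine colCount_append_add (fun x hx => by simpa using (List.mem_filter.1 hx).2)
    (fun t => ?_) t
  rw [colCount_replicate_append hℓk _ le_rfl]
  have e : k - ℓ + 1 - (k - ℓ + 1) + t = t := by omega
  rw [e]
  split_ifs <;> omega

theorem kCover_punion_rectangle_iff {k ℓ : ℕ} (hℓ : 1 ≤ ℓ) (hℓk : ℓ ≤ k) {l m : List ℕ}
    (hl : KBounded k l) (hm : KBounded k m) :
    KCover k (punion l (List.replicate (k - ℓ + 1) ℓ))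
      (punion m (List.replicate (k - ℓ + 1) ℓ)) ↔ KCover k l m := by
  have hR := kBounded_rectangle hℓ hℓk (k - ℓ + 1)
  have hl' := kBounded_punion hl hR
  have hm' := kBounded_punion hm hR
  simp only [KCover, hl, hm, hl', hm', true_and, subDiag_kConj_iff hl' hm',
    subDiag_kConj_iff hl hm, subDiag_iff_countP hl'.1.1 hm'.1.1, subDiag_iff_countP hl.1.1 hm.1.1,
    colCount_punion_rectangle hℓk hl, colCount_punion_rectangle hℓk hm, (punion_perm _ _).sum_eq,
    (punion_perm _ _).countP_eq, List.countP_append, List.sum_append, Nat.add_le_add_iff_right]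
  refine and_congr_right' (and_congr_right' ?_)
  omega

/-- Adding one cell raises exactly one of the numbers of parts exceeding `t`, and that by one. -/
theorem countP_eq_ite_of_countP_lt {k : ℕ} {l m : List ℕ} (hl : KBounded k l) (hm : KBounded k m)
    (h : SubDiag l m) (hsum : m.sum = l.sum + 1) {s : ℕ}
    (hs : l.countP (fun x => decide (s < x)) < m.countP (fun x => decide (s < x))) (t : ℕ) :
    m.countP (fun x => decide (t < x)) =
      l.countP (fun x => decide (t < x)) + if t = s then 1 else 0 := by
  have hle := (subDiag_iff_countP hl.1.1 hm.1.1).1 h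
  have hle' : ∀ u ∈ Finset.range (s + t + k + 1),
      l.countP (fun x => decide (u < x)) + (if u = s then 1 else 0) ≤
        m.countP (fun x => decide (u < x)) := by
    intro u _
    split_ifs with hus
    · subst hus; exact hs
    · exact hle u
  refine ((Finset.sum_eq_sum_iff_of_le hle').1 ?_ t (by simp; omega)).symm
  rw [Finset.sum_add_distrib, Finset.sum_ite_eq', if_pos (by simp; omega),
    ← sum_eq_sum_countP fun x hx => by have := (kBounded_iff.1 hl).2.2 x hx; omega,
    ← sum_eq_sum_countP fun x hx => by have := (kBounded_iff.1 hm).2.2 x hx; omega, hsum]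

theorem le_count_of_kCover_punion_rectangle {k ℓ : ℕ} (hℓ : 1 ≤ ℓ) (hℓk : ℓ ≤ k)
    {l m : List ℕ} (hl : KBounded k l)
    (h : KCover k (punion l (List.replicate (k - ℓ + 1) ℓ)) m) :
    k - ℓ + 1 ≤ m.count ℓ := by
  obtain ⟨hl', hm, hsub, hconj, hsum⟩ := h
  by_contra! hlt
  have hle := (subDiag_iff_countP hl'.1.1 hm.1.1).1 hsub
  have hcount : ∀ x, (punion l (List.replicate (k - ℓ + 1) ℓ)).count x =
      l.count x + if ℓ = x then k - ℓ + 1 else 0 := fun x => by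
    rw [(punion_perm _ _).count_eq, List.count_append, List.count_replicate]
    simp
  have key : ∀ (n : List ℕ) (x : ℕ), n.countP (fun y => decide (x < y)) =
      n.count (x + 1) + n.countP (fun y => decide (x + 1 < y)) := fun n x =>
    countP_lt_eq_count_add n (x + 1)
  have hraise : (punion l (List.replicate (k - ℓ + 1) ℓ)).countP (fun x => decide (ℓ < x)) <
      m.countP (fun x => decide (ℓ < x)) := by
    have h1 := key m (ℓ - 1)
    have h2 := key (punion l (List.replicate (k - ℓ + 1) ℓ)) (ℓ - 1)
    have h3 := hle (ℓ - 1)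
    rw [Nat.sub_add_cancel hℓ] at h1 h2
    have h4 := hcount ℓ
    rw [if_pos rfl] at h4
    omega
  have heq := countP_eq_ite_of_countP_lt hl' hm hsub hsum hraise
  have hcount_eq : ∀ x, 0 < x → x < ℓ → m.count x = l.count x := fun x hx0 hx => by
    have h1 := key m (x - 1)
    have h2 := key (punion l (List.replicate (k - ℓ + 1) ℓ)) (x - 1)
    have h3 := heq (x - 1)
    have h4 := heq x
    rw [if_neg (by omega)] at h3 h4
    have h5 := hcount x
    rw [Nat.sub_add_cancel hx0] at h1 h2
    rw [if_neg (by omega)] at h5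
    omega
  have hzero : l.count ℓ = 0 := by
    have h1 := key m (ℓ - 1)
    have h2 := key (punion l (List.replicate (k - ℓ + 1) ℓ)) (ℓ - 1)
    have h3 := heq (ℓ - 1)
    rw [if_neg (by omega)] at h3
    rw [Nat.sub_add_cancel hℓ] at h1 h2
    have h4 := hcount ℓ
    rw [if_pos rfl] at h4
    have h5 := heq ℓ
    rw [if_pos rfl] at h5
    omega
  have hmB := filter_le_eq_replicate_append hm.1.1 ℓ
  set B := m.filter (fun x => decide (x < ℓ)) with hB
  have hlB : l.filter (fun x => decide (x ≤ ℓ)) = B := by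
    rw [filter_le_eq_replicate_append hl.1.1 ℓ, hzero, List.replicate_zero, List.nil_append, hB]
    refine eq_of_perm_of_pairwise_ge (hl.1.1.filter _) (hm.1.1.filter _) ?_
    rw [List.perm_iff_count]
    intro x
    by_cases hx : x < ℓ
    · rw [List.count_filter (by simpa using hx), List.count_filter (by simpa using hx)]
      rcases Nat.eq_zero_or_pos x with rfl | hx0
      · rw [List.count_eq_zero_of_not_mem fun h => absurd (hl.1.2 _ h) (lt_irrefl _),
          List.count_eq_zero_of_not_mem fun h => absurd (hm.1.2 _ h) (lt_irrefl _)]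
      · exact (hcount_eq x hx0 hx).symm
    · rw [List.count_eq_zero_of_not_mem (by simp [hx]), List.count_eq_zero_of_not_mem (by simp [hx])]
  have hBk : KBounded k B := hm.sublist List.filter_sublist
  have hlt_of_mem : ∀ (n : List ℕ), ∀ x ∈ n.filter (fun x => decide (ℓ < x)), ℓ < x :=
    fun n x hx => by simpa using (List.mem_filter.1 hx).2
  have hcm : colCount k m (k - ℓ) ≤ colCount k B 0 := by
    rw [eq_filter_append_filter hm.1.1 ℓ, colCount_append_of_lt (hlt_of_mem m) _ le_rfl, hmB,
      colCount_replicate_append hℓk _ hlt.le, if_neg (by omega), if_neg (by omega)]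
    exact colCount_antitone hBk (Nat.zero_le _)
  have hcl : colCount k l (k - ℓ) = colCount k B (k - ℓ) := by
    rw [← hlB]
    nth_rewrite 1 [eq_filter_append_filter hl.1.1 ℓ]
    exact colCount_append_of_lt (hlt_of_mem l) _ le_rfl
  have h1 := (subDiag_kConj_iff hl' hm).1 hconj (k - ℓ)
  rw [colCount_punion_rectangle hℓk hl, if_pos (by omega), hcl] at h1
  have h2 : colCount k B 0 ≤ colCount k B (k - (ℓ - 1)) + (ℓ - 1) :=
    colCount_zero_le (by omega) hBk fun x hx => by
      have := (List.mem_filter.1 hx).2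
      simp at this
      omega
  have h3 : colCount k B (k - (ℓ - 1)) ≤ colCount k B (k - ℓ) := colCount_antitone hBk (by omega)
  omega

theorem exists_kCover_of_kCover_punion_rectangle {k ℓ : ℕ} (hℓ : 1 ≤ ℓ) (hℓk : ℓ ≤ k)
    {l m : List ℕ} (hl : KBounded k l)
    (h : KCover k (punion l (List.replicate (k - ℓ + 1) ℓ)) m) :
    ∃ n, KBounded k n ∧ m = punion n (List.replicate (k - ℓ + 1) ℓ) ∧ KCover k l n := by
  have hcount := le_count_of_kCover_punion_rectangle hℓ hℓk hl h
  have hm := h.2.1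
  have hn : KBounded k (m.diff (List.replicate (k - ℓ + 1) ℓ)) :=
    hm.sublist (List.diff_sublist _ _)
  have heq : m = punion (m.diff (List.replicate (k - ℓ + 1) ℓ)) (List.replicate (k - ℓ + 1) ℓ) := by
    refine eq_of_perm_of_pairwise_ge hm.1.1 (punion_pairwise _ _) ?_
    refine List.Perm.trans ?_ (List.perm_append_comm.trans (punion_perm _ _).symm)
    refine (List.subperm_append_diff_self_of_count_le fun x hx => ?_).symm
    rw [List.eq_of_mem_replicate hx, List.count_replicate_self]
    exact hcount
  refine ⟨_, hn, heq, (kCover_punion_rectangle_iff hℓ hℓk hl hn).1 ?_⟩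
  rwa [← heq]

/-- `(λ ∪ □) ≼ μ` in the `k`-Young order iff `μ = μ̄ ∪ □` and `λ ≼ μ̄`
for some `k`-bounded partition `μ̄`. -/
theorem kLe_union_kRectangle_iff (k ℓ : ℕ) (hℓ : 1 ≤ ℓ) (hℓk : ℓ ≤ k) (lam μ : List ℕ)
    (hlam : KBounded k lam) (hμ : KBounded k μ) :
    KLe k (punion lam (List.replicate (k - ℓ + 1) ℓ)) μ ↔
      ∃ ν : List ℕ, KBounded k ν ∧ μ = punion ν (List.replicate (k - ℓ + 1) ℓ) ∧
        KLe k lam ν := by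
  constructor
  · intro h
    clear hμ
    induction h with
    | refl => exact ⟨lam, hlam, rfl, .refl⟩
    | tail _ hcov ih =>
      obtain ⟨ν, hν, rfl, hle⟩ := ih
      obtain ⟨ν', hν', heq, hcov'⟩ := exists_kCover_of_kCover_punion_rectangle hℓ hℓk hν hcov
      exact ⟨ν', hν', heq, hle.tail hcov'⟩
  · rintro ⟨ν, -, rfl, hle⟩
    clear hμ
    induction hle with
    | refl => exact .refl
    | tail _ hcov ih =>
      exact ih.tail ((kCover_punion_rectangle_iff hℓ hℓk hcov.1 hcov.2.1).2 hcov)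
end
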